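/- Suppose p = p(n) is such that d = d(n) = p(n−1) ≥ log³n. Then for every η ∈ (0,1), a.a.s. the random graph G ∈ G(n,p) satisfies: for every vertex v ∈ [n] and every natural number r such that √n < d^{r+1} ≤ √n·log n, there exists a family {W(u) ⊆ S(u,r+1) : u ∈ S(v,r)} of pairwise disjoint subsets of [n] such that (1−η)·d^{r+1} ≤ |W(u)| ≤ (1+η)·d^{r+1} for each u ∈ S(v,r). -/

import Mathlib

open MeasureTheory

/-- The Erdős–Rényi random graph measure: product over unordered pairs of distinct
vertices of Bernoulli(p) measures on `{0,1} ≅ Bool`. -/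
noncomputable def gnp (n : ℕ) (p : ℝ) :
    Measure ({e : Sym2 (Fin n) // ¬ e.IsDiag} → Bool) :=
  Measure.pi fun _ => (PMF.bernoulli (min (Real.toNNReal p) 1) (min_le_right _ _)).toMeasure

/-- The simple graph determined coordinatewise by a point of the product space. -/
def graphOf {n : ℕ} (ω : {e : Sym2 (Fin n) // ¬ e.IsDiag} → Bool) : SimpleGraph (Fin n) :=
  SimpleGraph.fromEdgeSet {e | ∃ h : ¬ e.IsDiag, ω ⟨e, h⟩ = true}

/-- `S(v,r)`: vertices at graph distance exactly `r` from `v`. -/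
def sphere {n : ℕ} (G : SimpleGraph (Fin n)) (v : Fin n) (r : ℕ) : Set (Fin n) :=
  {w | G.Reachable v w ∧ G.dist v w = r}

section Abstract
open ProbabilityTheory

variable {E : Type*} [Fintype E]

lemma integral_mul_of_dep (ν : Measure Bool) [IsProbabilityMeasure ν]
    (f g : (E → Bool) → ℝ) (F : Set E) (hf : DependsOn f F) (hg : DependsOn g Fᶜ) :
    ∫ ω, f ω * g ω ∂(Measure.pi fun _ : E => ν)
      = (∫ ω, f ω ∂(Measure.pi fun _ : E => ν)) * ∫ ω, g ω ∂(Measure.pi fun _ : E => ν) := by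
  classical
  obtain ⟨f', rfl⟩ := dependsOn_iff_exists_comp.1 hf
  obtain ⟨g', rfl⟩ := dependsOn_iff_exists_comp.1 hg
  have h1 : iIndepFun (fun (i : E) (ω : E → Bool) => ω i) (Measure.pi fun _ : E => ν) :=
    iIndepFun_pi (X := fun _ b => b) (fun i => aemeasurable_id)
  have h2 := h1.indepFun_finset F.toFinset (Fᶜ).toFinset
    (by rw [Set.disjoint_toFinset]; exact disjoint_compl_right) (fun i => measurable_pi_apply i)
  have h3 := h2.comp
    (φ := fun y : F.toFinset → Bool => f' (fun i : F => y ⟨i.1, by simp⟩))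
    (ψ := fun y : (Fᶜ).toFinset → Bool => g' (fun i : (Fᶜ : Set E) => y ⟨i.1, by
      rw [Set.mem_toFinset]; exact i.2⟩))
    (Measurable.of_discrete) (Measurable.of_discrete)
  exact h3.integral_mul_eq_mul_integral Measurable.of_discrete.aestronglyMeasurable
    Measurable.of_discrete.aestronglyMeasurable

lemma integral_prod_of_dep {ι : Type*} (ν : Measure Bool) [IsProbabilityMeasure ν]
    (J : Finset ι) (f : ι → (E → Bool) → ℝ) (S : ι → Set E)
    (hS : ∀ i ∈ J, ∀ j ∈ J, i ≠ j → Disjoint (S i) (S j))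
    (hf : ∀ i ∈ J, DependsOn (f i) (S i)) :
    ∫ ω, ∏ i ∈ J, f i ω ∂(Measure.pi fun _ : E => ν)
      = ∏ i ∈ J, ∫ ω, f i ω ∂(Measure.pi fun _ : E => ν) := by
  classical
  induction J using Finset.induction_on with
  | empty => simp
  | insert a J ha ih =>
    rw [Finset.prod_insert ha, ← ih]
    · simp_rw [Finset.prod_insert ha]
      refine integral_mul_of_dep ν (f a) (fun ω => ∏ i ∈ J, f i ω) (S a)
        (hf a (Finset.mem_insert_self _ _)) ?_
      intro x y hxy
      refine Finset.prod_congr rfl fun i hi => ?_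
      refine hf i (Finset.mem_insert_of_mem hi) fun e he => hxy e ?_
      have : i ≠ a := fun h => ha (h ▸ hi)
      exact (Set.disjoint_left.1 (hS i (Finset.mem_insert_of_mem hi) a
        (Finset.mem_insert_self _ _) this) he)
    · exact fun i hi j hj => hS i (Finset.mem_insert_of_mem hi) j (Finset.mem_insert_of_mem hj)
    · exact fun i hi => hf i (Finset.mem_insert_of_mem hi)

open Classical in
lemma chernoff {ι : Type*} (ν : Measure Bool) [IsProbabilityMeasure ν]
    (J : Finset ι) (A : ι → Set (E → Bool)) (S : ι → Set E)
    (hS : ∀ i ∈ J, ∀ j ∈ J, i ≠ j → Disjoint (S i) (S j))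
    (hA : ∀ i ∈ J, DependsOn (fun ω => ω ∈ A i) (S i)) (q : ℝ)
    (hq : ∀ i ∈ J, (Measure.pi fun _ : E => ν).real (A i) = q) (θ t : ℝ) :
    (Measure.pi fun _ : E => ν).real {ω | θ * t ≤ θ * ((J.filter (fun i => ω ∈ A i)).card : ℝ)}
      ≤ Real.exp (-(θ * t) + J.card * (q * (Real.exp θ - 1))) := by
  set P := (Measure.pi fun _ : E => ν) with hP
  let f : ι → (E → Bool) → ℝ := fun i ω => if ω ∈ A i then Real.exp θ else 1
  have hprod : ∀ ω, ∏ i ∈ J, f i ω = Real.exp (θ * ((J.filter (fun i => ω ∈ A i)).card : ℝ)) := by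
    intro ω
    simp only [f]
    rw [Finset.prod_ite]
    simp [← Real.exp_nat_mul, mul_comm]
  have hint : ∀ i ∈ J, ∫ ω, f i ω ∂P = 1 + q * (Real.exp θ - 1) := by
    intro i hi
    have : f i = fun ω => 1 + (A i).indicator (fun _ => Real.exp θ - 1) ω := by
      funext ω
      simp only [f, Set.indicator]
      split_ifs <;> ring
    rw [this, integral_add (Integrable.of_finite) (Integrable.of_finite),
      integral_indicator (MeasurableSet.of_discrete)]
    simp [hq i hi]
  have hE : ∫ ω, ∏ i ∈ J, f i ω ∂P ≤ Real.exp (J.card * (q * (Real.exp θ - 1))) := by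
    rw [hP, integral_prod_of_dep ν J f S hS, ← hP, Finset.prod_congr rfl hint, Finset.prod_const,
      Real.exp_nat_mul]
    · rcases J.eq_empty_or_nonempty with rfl | ⟨i, hi⟩
      · simp
      · refine pow_le_pow_left₀ ?_ (by linarith [Real.add_one_le_exp (q * (Real.exp θ - 1))]) _
        rw [← hint i hi]
        refine integral_nonneg fun ω => ?_
        simp only [f]
        split_ifs <;> positivity
    · intro i hi x y hxy
      simp only [f]
      have := hA i hi hxy
      simp only [eq_iff_iff] at this
      simp only [this]
  have hM : Real.exp (θ * t) * P.real {ω | Real.exp (θ * t) ≤ ∏ i ∈ J, f i ω}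
      ≤ ∫ ω, ∏ i ∈ J, f i ω ∂P := by
    refine mul_meas_ge_le_integral_of_nonneg (ae_of_all _ fun ω => ?_) (Integrable.of_finite) _
    simp only [hprod]
    positivity
  have hset : {ω | θ * t ≤ θ * ((J.filter (fun i => ω ∈ A i)).card : ℝ)}
      = {ω | Real.exp (θ * t) ≤ ∏ i ∈ J, f i ω} := by
    ext ω
    simp [hprod]
  rw [hset, Real.exp_add, Real.exp_neg, ← div_eq_inv_mul, le_div_iff₀ (Real.exp_pos _), mul_comm]
  exact hM.trans hE

lemma history_bound {H : Type*} [Fintype H] (ν : Measure Bool) [IsProbabilityMeasure ν]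
    (h : (E → Bool) → H) (B : H → Set (E → Bool)) (F : H → Set E) (δ : ℝ)
    (hh : ∀ x, DependsOn (fun ω => h ω = x) (F x)ᶜ)
    (hB : ∀ x, DependsOn (fun ω => ω ∈ B x) (F x))
    (hP : ∀ x, (Measure.pi fun _ : E => ν).real (B x) ≤ δ) :
    (Measure.pi fun _ : E => ν).real {ω | ω ∈ B (h ω)} ≤ δ := by
  classical
  set P := (Measure.pi fun _ : E => ν) with hPdef
  have key : ∀ x, P.real ({ω | h ω = x} ∩ B x) = P.real {ω | h ω = x} * P.real (B x) := by
    intro x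
    have := integral_mul_of_dep ν ((B x).indicator 1) ({ω | h ω = x}.indicator 1) (F x) ?_ ?_
    · rw [← hPdef, integral_indicator_one MeasurableSet.of_discrete,
        integral_indicator_one MeasurableSet.of_discrete] at this
      rw [mul_comm, ← this, ← integral_indicator_one MeasurableSet.of_discrete, Set.inter_comm]
      congr 1
      funext ω
      simp only [Set.indicator, Set.mem_inter_iff, Pi.one_apply]
      split_ifs <;> simp_all
    · intro a b hab
      have := hB x hab
      simp only [eq_iff_iff] at this
      simp only [Set.indicator, this, Pi.one_apply]
    · intro a b hab
      have := hh x hab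
      simp only [eq_iff_iff] at this
      simp only [Set.indicator, Set.mem_ofPred_eq, this, Pi.one_apply]
  have hU : {ω | ω ∈ B (h ω)} = ⋃ x ∈ (Finset.univ : Finset H), ({ω | h ω = x} ∩ B x) := by
    ext ω; simp
  have hU1 : (Set.univ : Set (E → Bool)) = ⋃ x ∈ (Finset.univ : Finset H), {ω | h ω = x} := by
    ext ω; simp
  have hsum : ∑ x : H, P.real {ω | h ω = x} = 1 := by
    rw [← measureReal_biUnion_finset, ← hU1]
    · simp [hPdef]
    · intro x _ y _ hxy
      refine Set.disjoint_left.2 fun ω h1 h2 => hxy ?_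
      exact h1.symm.trans h2
    · exact fun _ _ => MeasurableSet.of_discrete
  calc P.real {ω | ω ∈ B (h ω)} ≤ ∑ x : H, P.real ({ω | h ω = x} ∩ B x) := by
        rw [hU]; exact measureReal_biUnion_finset_le _ _
    _ ≤ ∑ x : H, P.real {ω | h ω = x} * δ := by
        refine Finset.sum_le_sum fun x _ => ?_
        rw [key]
        exact mul_le_mul_of_nonneg_left (hP x) measureReal_nonneg
    _ = δ := by rw [← Finset.sum_mul, hsum, one_mul]

end Abstract
section Det
open Classical

variable {n : ℕ}

noncomputable def ball (G : SimpleGraph (Fin n)) (v : Fin n) : ℕ → Finset (Fin n)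
  | 0 => {v}
  | k + 1 => Finset.univ.filter fun w => w = v ∨ ∃ b ∈ ball G v k, G.Adj b w

noncomputable def pball (G : SimpleGraph (Fin n)) (v : Fin n) : ℕ → Finset (Fin n)
  | 0 => ∅
  | k + 1 => ball G v k

noncomputable def kids (G : SimpleGraph (Fin n)) (X L : Finset (Fin n)) (a : Fin n) :
    Finset (Fin n) :=
  Xᶜ.filter fun w => ∀ b ∈ L, (G.Adj b w ↔ b = a)

lemma mem_ball_succ {G : SimpleGraph (Fin n)} {v w : Fin n} {k : ℕ} :
    w ∈ ball G v (k + 1) ↔ w = v ∨ ∃ b ∈ ball G v k, G.Adj b w := by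
  simp [ball]

lemma self_mem_ball (G : SimpleGraph (Fin n)) (v : Fin n) (k : ℕ) : v ∈ ball G v k := by
  cases k <;> simp [ball]

lemma ball_subset_succ (G : SimpleGraph (Fin n)) (v : Fin n) (k : ℕ) :
    ball G v k ⊆ ball G v (k + 1) := by
  induction k with
  | zero => intro w hw; simp [ball] at hw; subst hw; exact self_mem_ball _ _ _
  | succ k ih =>
    intro w hw
    rw [mem_ball_succ] at hw ⊢
    rcases hw with h | ⟨b, hb, h⟩
    · exact Or.inl h
    · exact Or.inr ⟨b, ih hb, h⟩

lemma ball_mono (G : SimpleGraph (Fin n)) (v : Fin n) : Monotone (ball G v) :=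
  monotone_nat_of_le_succ (ball_subset_succ G v)

lemma mem_ball_iff {G : SimpleGraph (Fin n)} {v w : Fin n} {k : ℕ} :
    w ∈ ball G v k ↔ ∃ q : G.Walk v w, q.length ≤ k := by
  constructor
  · intro h
    induction k generalizing w with
    | zero => simp [ball] at h; subst h; exact ⟨.nil, by simp⟩
    | succ k ih =>
      rcases mem_ball_succ.1 h with rfl | ⟨b, hb, hbw⟩
      · exact ⟨.nil, by simp⟩
      · obtain ⟨q, hq⟩ := ih hb
        exact ⟨q.concat hbw, by simp; omega⟩
  · rintro ⟨q, hq⟩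
    induction q using SimpleGraph.Walk.concatRec generalizing k with
    | Hnil => exact self_mem_ball _ _ _
    | Hconcat q h ih =>
      simp at hq
      obtain ⟨k, rfl⟩ : ∃ k', k = k' + 1 := ⟨k - 1, by omega⟩
      exact mem_ball_succ.2 (Or.inr ⟨_, ih (by omega), h⟩)

lemma mem_level_of_sphere {G : SimpleGraph (Fin n)} {v w : Fin n} {k : ℕ}
    (h : w ∈ sphere G v k) : w ∈ ball G v k \ pball G v k := by
  obtain ⟨h1, h2⟩ := h
  rw [Finset.mem_sdiff]
  constructor
  · obtain ⟨q, hq⟩ := h1.exists_walk_length_eq_dist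
    exact mem_ball_iff.2 ⟨q, by omega⟩
  · intro h3
    cases k with
    | zero => simp [pball] at h3
    | succ k =>
      obtain ⟨q, hq⟩ := mem_ball_iff.1 h3
      have := SimpleGraph.dist_le q
      omega

lemma ball_card_le (G : SimpleGraph (Fin n)) (v : Fin n) (D : ℝ) (hD : 2 ≤ D)
    (hdeg : ∀ a, ((Finset.univ.filter fun w => G.Adj a w).card : ℝ) ≤ D) (k : ℕ) :
    ((ball G v k).card : ℝ) ≤ 2 * D ^ k - 1 := by
  induction k with
  | zero => simp [ball]; norm_num
  | succ k ih =>
    have hsub : ball G v (k + 1) ⊆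
        insert v ((ball G v k).biUnion fun b => Finset.univ.filter fun w => G.Adj b w) := by
      intro w hw
      rcases mem_ball_succ.1 hw with rfl | ⟨b, hb, h⟩
      · simp
      · simp only [Finset.mem_insert, Finset.mem_biUnion, Finset.mem_filter, Finset.mem_univ,
          true_and]
        exact Or.inr ⟨b, hb, h⟩
    have h1 := (Finset.card_le_card hsub).trans (Finset.card_insert_le _ _)
    have h2 : ((ball G v (k + 1)).card : ℝ) ≤
        ((((ball G v k).biUnion fun b => Finset.univ.filter fun w => G.Adj b w).card : ℕ) : ℝ)
          + 1 := by exact_mod_cast h1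
    have h3 : ((((ball G v k).biUnion fun b => Finset.univ.filter fun w => G.Adj b w).card : ℕ) : ℝ)
        ≤ ∑ b ∈ ball G v k, ((Finset.univ.filter fun w => G.Adj b w).card : ℝ) := by
      exact_mod_cast Finset.card_biUnion_le
    have h4 : ∑ b ∈ ball G v k, ((Finset.univ.filter fun w => G.Adj b w).card : ℝ)
        ≤ (ball G v k).card * D := by
      rw [← nsmul_eq_mul]
      exact Finset.sum_le_card_nsmul _ _ _ fun b _ => hdeg b
    have h5 : ((ball G v k).card : ℝ) * D ≤ (2 * D ^ k - 1) * D :=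
      mul_le_mul_of_nonneg_right ih (by linarith)
    have h6 : (2 * D ^ k - 1) * D = 2 * D ^ (k + 1) - D := by ring
    linarith

noncomputable def desc (G : SimpleGraph (Fin n)) (v : Fin n) (r : ℕ) (u : Fin n) :
    ℕ → Finset (Fin n)
  | 0 => {u}
  | j + 1 => (desc G v r u j).biUnion fun a =>
      kids G (ball G v (r + j)) (ball G v (r + j) \ pball G v (r + j)) a

lemma desc_level {G : SimpleGraph (Fin n)} {v u : Fin n} {r : ℕ}
    (hu : u ∈ ball G v r \ pball G v r) (j : ℕ) :
    desc G v r u j ⊆ ball G v (r + j) \ pball G v (r + j) := by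
  induction j with
  | zero => simpa [desc] using hu
  | succ j ih =>
    intro w hw
    simp only [desc, Finset.mem_biUnion] at hw
    obtain ⟨a, ha, hw⟩ := hw
    simp only [kids, Finset.mem_filter, Finset.mem_compl] at hw
    have ha' := ih ha
    rw [Finset.mem_sdiff]
    refine ⟨mem_ball_succ.2 (Or.inr ⟨a, (Finset.mem_sdiff.1 ha').1, (hw.2 a ha').2 rfl⟩), ?_⟩
    exact hw.1

lemma desc_walk {G : SimpleGraph (Fin n)} {v u : Fin n} {r : ℕ}
    (hu : u ∈ ball G v r \ pball G v r) (j : ℕ) {w : Fin n} (hw : w ∈ desc G v r u j) :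
    ∃ q : G.Walk u w, q.length = j := by
  induction j generalizing w with
  | zero => simp [desc] at hw; subst hw; exact ⟨.nil, rfl⟩
  | succ j ih =>
    simp only [desc, Finset.mem_biUnion] at hw
    obtain ⟨a, ha, hw⟩ := hw
    simp only [kids, Finset.mem_filter, Finset.mem_compl] at hw
    obtain ⟨q, hq⟩ := ih ha
    exact ⟨q.concat ((hw.2 a (desc_level hu j ha)).2 rfl), by simp [hq]⟩

lemma desc_disj {G : SimpleGraph (Fin n)} {v u u' : Fin n} {r : ℕ}
    (hu : u ∈ ball G v r \ pball G v r) (hu' : u' ∈ ball G v r \ pball G v r) (j : ℕ) {w : Fin n}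
    (hw : w ∈ desc G v r u j) (hw' : w ∈ desc G v r u' j) : u = u' := by
  induction j generalizing w with
  | zero => simp [desc] at hw hw'; rw [← hw, ← hw']
  | succ j ih =>
    simp only [desc, Finset.mem_biUnion] at hw hw'
    obtain ⟨a, ha, hw⟩ := hw
    obtain ⟨a', ha', hw'⟩ := hw'
    simp only [kids, Finset.mem_filter, Finset.mem_compl] at hw hw'
    have h1 := (hw.2 a (desc_level hu j ha)).2 rfl
    have h2 := (hw'.2 a (desc_level hu j ha)).1 h1
    subst h2
    exact ih ha ha'

lemma desc_card {G : SimpleGraph (Fin n)} {v u : Fin n} {r : ℕ}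
    (hu : u ∈ ball G v r \ pball G v r) (c : ℝ) (hc : 0 ≤ c) (m : ℕ)
    (hk : ∀ j < m, ∀ a ∈ ball G v (r + j) \ pball G v (r + j),
      c ≤ (kids G (ball G v (r + j)) (ball G v (r + j) \ pball G v (r + j)) a).card) :
    c ^ m ≤ (desc G v r u m).card := by
  induction m with
  | zero => simp [desc]
  | succ m ih =>
    have h1 := ih fun j hj => hk j (by omega)
    simp only [desc]
    rw [Finset.card_biUnion]
    · push_cast
      calc c ^ (m + 1) = c ^ m * c := pow_succ _ _
        _ ≤ (desc G v r u m).card * c := mul_le_mul_of_nonneg_right h1 hc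
        _ ≤ _ := by
          rw [← nsmul_eq_mul]
          exact Finset.card_nsmul_le_sum _ _ _ fun a ha => hk m (by omega) a (desc_level hu m ha)
    · intro a ha a' _ haa
      refine Finset.disjoint_left.2 ?_
      intro w hw hw'
      simp only [kids, Finset.mem_filter, Finset.mem_compl] at hw hw'
      exact haa ((hw'.2 a (desc_level hu m ha)).1 ((hw.2 a (desc_level hu m ha)).2 rfl))

lemma desc_sphere {G : SimpleGraph (Fin n)} {v u : Fin n} {r : ℕ}
    (hu : u ∈ sphere G v r) {w : Fin n} (hw : w ∈ desc G v r u (r + 1)) :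
    w ∈ sphere G u (r + 1) := by
  have hu' := mem_level_of_sphere hu
  obtain ⟨q, hq⟩ := desc_walk hu' _ hw
  refine ⟨⟨q⟩, le_antisymm (hq ▸ SimpleGraph.dist_le q) ?_⟩
  by_contra hlt
  obtain ⟨q', hq'⟩ := (SimpleGraph.Walk.reachable q).exists_walk_length_eq_dist
  obtain ⟨q0, hq0⟩ := hu.1.exists_walk_length_eq_dist
  have h2 := hu.2
  have hl := desc_level hu' _ hw
  rw [Finset.mem_sdiff] at hl
  have hpb : pball G v (r + (r + 1)) = ball G v (r + r) := rfl
  refine hl.2 (hpb ▸ mem_ball_iff.2 ⟨q0.append q', ?_⟩)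
  rw [SimpleGraph.Walk.length_append]
  omega

lemma det_main (G : SimpleGraph (Fin n)) (v : Fin n) (r : ℕ) (c lo hi : ℝ) (hc : 0 ≤ c)
    (hk : ∀ j < r + 1, ∀ a ∈ ball G v (r + j) \ pball G v (r + j),
      c ≤ (kids G (ball G v (r + j)) (ball G v (r + j) \ pball G v (r + j)) a).card)
    (hlo : lo ≤ c ^ (r + 1)) (h0 : 0 ≤ lo) (hhi : lo + 1 ≤ hi) :
    ∃ W : Fin n → Set (Fin n),
      (∀ u ∈ sphere G v r, W u ⊆ sphere G u (r + 1)) ∧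
      ((sphere G v r).Pairwise fun u₁ u₂ => Disjoint (W u₁) (W u₂)) ∧
      (∀ u ∈ sphere G v r, lo ≤ ((W u).ncard : ℝ) ∧ ((W u).ncard : ℝ) ≤ hi) := by
  have hex : ∀ u, ∃ T : Finset (Fin n), u ∈ sphere G v r →
      T ⊆ desc G v r u (r + 1) ∧ T.card = ⌈lo⌉₊ := by
    intro u
    by_cases hu : u ∈ sphere G v r
    · have := desc_card (mem_level_of_sphere hu) c hc (r + 1) hk
      obtain ⟨T, h1, h2⟩ := Finset.exists_subset_card_eq (s := desc G v r u (r + 1)) (n := ⌈lo⌉₊)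
        (Nat.ceil_le.2 (hlo.trans this))
      exact ⟨T, fun _ => ⟨h1, h2⟩⟩
    · exact ⟨∅, fun h => absurd h hu⟩
  choose T hT using hex
  refine ⟨fun u => (T u : Set (Fin n)), ?_, ?_, ?_⟩
  · intro u hu w hw
    exact desc_sphere hu ((hT u hu).1 hw)
  · intro u hu u' hu' hne
    rw [Set.disjoint_left]
    intro w hw hw'
    exact hne (desc_disj (mem_level_of_sphere hu) (mem_level_of_sphere hu') _
      ((hT u hu).1 hw) ((hT u' hu').1 hw'))
  · intro u hu
    simp only [Set.ncard_coe_finset, (hT u hu).2]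
    exact ⟨Nat.le_ceil _, (Nat.ceil_lt_add_one h0).le.trans hhi⟩

end Det
section Prob
open Classical

variable {n : ℕ}

abbrev Om (n : ℕ) : Type := {e : Sym2 (Fin n) // ¬ e.IsDiag} → Bool

noncomputable def nu (p : ℝ) : Measure Bool :=
  (PMF.bernoulli (min (Real.toNNReal p) 1) (min_le_right _ _)).toMeasure

instance (p : ℝ) : IsProbabilityMeasure (nu p) := by
  unfold nu; infer_instance

lemma gnp_eq (n : ℕ) (p : ℝ) : gnp n p = Measure.pi fun _ => nu p := rfl

instance (p : ℝ) : IsProbabilityMeasure (gnp n p) := by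
  rw [gnp_eq]; infer_instance

lemma nu_true (p : ℝ) (h0 : 0 ≤ p) (h1 : p ≤ 1) : (nu p).real {true} = p := by
  have : min (Real.toNNReal p) 1 = Real.toNNReal p := by
    rw [min_eq_left]
    exact Real.toNNReal_le_one.2 h1
  simp only [nu, Measure.real]
  rw [PMF.toMeasure_apply_singleton _ _ (measurableSet_singleton _), PMF.bernoulli_apply]
  simp [this, h0]

lemma adj_iff {ω : {e : Sym2 (Fin n) // ¬ e.IsDiag} → Bool} {a b : Fin n} :
    (graphOf ω).Adj a b ↔ ∃ h : ¬ (s(a, b)).IsDiag, ω ⟨s(a, b), h⟩ = true := by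
  unfold graphOf
  rw [SimpleGraph.fromEdgeSet_adj]
  constructor
  · exact fun h => h.1
  · rintro ⟨h, h'⟩
    exact ⟨⟨h, h'⟩, by simpa using h⟩

lemma adj_dep (b w : Fin n) :
    DependsOn (fun ω : {e : Sym2 (Fin n) // ¬ e.IsDiag} → Bool => (graphOf ω).Adj b w)
      {e | e.1 = s(b, w)} := by
  intro x y hxy
  simp only [eq_iff_iff, adj_iff]
  constructor
  · rintro ⟨h, h'⟩; exact ⟨h, by rw [← hxy ⟨s(b, w), h⟩ rfl]; exact h'⟩
  · rintro ⟨h, h'⟩; exact ⟨h, by rw [hxy ⟨s(b, w), h⟩ rfl]; exact h'⟩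

lemma adj_prob (p : ℝ) (h0 : 0 ≤ p) (h1 : p ≤ 1) (a b : Fin n) (hab : a ≠ b) :
    (gnp n p).real {ω | (graphOf ω).Adj a b} = p := by
  have h : ¬ (s(a, b)).IsDiag := by simpa using hab
  have hs : {ω : {e : Sym2 (Fin n) // ¬ e.IsDiag} → Bool | (graphOf ω).Adj a b}
      = (fun ω : Om n => ω ⟨s(a, b), h⟩) ⁻¹' {true} := by
    ext ω
    simp only [Set.mem_ofPred_eq, adj_iff, Set.mem_preimage, Set.mem_singleton_iff]
    exact ⟨fun ⟨_, h⟩ => h, fun h' => ⟨h, h'⟩⟩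
  have hmp := measurePreserving_eval
    (fun _ : {e : Sym2 (Fin n) // ¬ e.IsDiag} => nu p) ⟨s(a, b), h⟩
  rw [hs, gnp_eq, measureReal_def, hmp.measure_preimage
    MeasurableSet.of_discrete.nullMeasurableSet, ← measureReal_def, nu_true p h0 h1]

lemma star_prob (p : ℝ) (h0 : 0 ≤ p) (h1 : p ≤ 1) (L : Finset (Fin n)) (a w : Fin n)
    (ha : a ∈ L) (hw : w ∉ L) :
    (gnp n p).real {ω | ∀ b ∈ L, ((graphOf ω).Adj b w ↔ b = a)} = p * (1 - p) ^ (L.card - 1) := by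
  have hs : {ω : Om n | ∀ b ∈ L, ((graphOf ω).Adj b w ↔ b = a)}.indicator (1 : Om n → ℝ)
     = fun ω : {e : Sym2 (Fin n) // ¬ e.IsDiag} → Bool =>
        ∏ b ∈ L, {ω : Om n | ((graphOf ω).Adj b w ↔ b = a)}.indicator (1 : Om n → ℝ) ω := by
    funext ω
    by_cases h : ∀ b ∈ L, ((graphOf ω).Adj b w ↔ b = a)
    · rw [Set.indicator_of_mem (by exact h), Finset.prod_eq_one]
      · rfl
      · intro b hb
        rw [Set.indicator_of_mem (by exact h b hb)]; rfl
    · rw [Set.indicator_of_notMem (by exact h)]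
      push Not at h
      obtain ⟨b, hb, h⟩ := h
      rw [Finset.prod_eq_zero hb]
      rw [Set.indicator_of_notMem]
      simp only [Set.mem_ofPred_eq]
      tauto
  rw [← integral_indicator_one MeasurableSet.of_discrete, hs, gnp_eq,
    integral_prod_of_dep (nu p) L _ (fun b => {e | e.1 = s(b, w)}), ← gnp_eq]
  · have : ∀ b ∈ L, ∫ ω, {ω : Om n | ((graphOf ω).Adj b w ↔ b = a)}.indicator (1 : Om n → ℝ) ω ∂(gnp n p)
        = if b = a then p else 1 - p := by
      intro b hb
      have hbw : b ≠ w := fun h => hw (h ▸ hb)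
      rw [integral_indicator_one MeasurableSet.of_discrete]
      split_ifs with hba
      · simp only [hba, iff_true]
        subst hba
        exact adj_prob p h0 h1 _ _ hbw
      · simp only [hba, iff_false]
        have := measureReal_compl (μ := gnp n p)
          (MeasurableSet.of_discrete (s := {ω | (graphOf ω).Adj b w}))
        rw [adj_prob p h0 h1 _ _ hbw] at this
        rw [probReal_univ] at this
        exact this
    rw [Finset.prod_congr rfl this, ← Finset.mul_prod_erase L _ ha]
    simp only [if_true]
    congr 1
    rw [Finset.prod_congr rfl (g := fun _ => 1 - p), Finset.prod_const, Finset.card_erase_of_mem ha]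
    intro b hb
    rw [if_neg (Finset.ne_of_mem_erase hb)]
  · intro b hb b' hb' hne
    rw [Set.disjoint_left]
    intro e he he'
    simp only [Set.mem_ofPred_eq] at he he'
    rw [he] at he'
    simp only [Sym2.eq_iff] at he'
    rcases he' with h | h
    · exact hne h.1
    · exact hw (h.1 ▸ hb)
  · intro b hb x y hxy
    have := adj_dep b w hxy
    simp only [eq_iff_iff] at this
    simp only [Set.indicator, Set.mem_ofPred_eq, this, Pi.one_apply]

/-- Upper tail for degrees. -/
lemma deg_bound (p ℓ : ℝ) (h0 : 0 ≤ p) (h1 : p ≤ 1) (hℓ : 4 ≤ ℓ) (hn : 1 ≤ n)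
    (hd : ℓ ^ 3 ≤ p * ((n : ℝ) - 1)) (a : Fin n) :
    (gnp n p).real {ω | (1 + 4 / ℓ) * (p * ((n : ℝ) - 1)) ≤
      ((Finset.univ.filter fun w => (graphOf ω).Adj a w).card : ℝ)} ≤ Real.exp (-(4 * ℓ)) := by
  set d := p * ((n : ℝ) - 1) with hd'
  have hℓ0 : 0 < ℓ := by linarith
  have key := chernoff (nu p) (Finset.univ.erase a)
    (fun w => {ω : {e : Sym2 (Fin n) // ¬ e.IsDiag} → Bool | (graphOf ω).Adj a w})
    (fun w => {e | e.1 = s(a, w)}) ?_ ?_ p ?_ (2 / ℓ) ((1 + 4 / ℓ) * d)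
  · rw [← gnp_eq] at key
    refine (measureReal_mono ?_).trans (key.trans ?_)
    · intro ω hω
      simp only [Set.mem_ofPred_eq] at hω ⊢
      have : (Finset.univ.erase a).filter (fun w => (graphOf ω).Adj a w)
          = Finset.univ.filter (fun w => (graphOf ω).Adj a w) := by
        ext w
        simp only [Finset.mem_filter, Finset.mem_erase, Finset.mem_univ, true_and, and_true]
        exact ⟨fun h => h.2, fun h => ⟨h.ne', h⟩⟩
      rw [this]
      exact mul_le_mul_of_nonneg_left hω (by positivity)
    · rw [Real.exp_le_exp]
      have hc : ((Finset.univ.erase a).card : ℝ) = (n : ℝ) - 1 := by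
        rw [Finset.card_erase_of_mem (Finset.mem_univ _)]
        simp [hn]
      rw [hc]
      have he : Real.exp (2 / ℓ) - 1 ≤ 2 / ℓ + (2 / ℓ) ^ 2 := by
        have hx : |2 / ℓ| ≤ 1 := by
          rw [abs_of_pos (by positivity), div_le_one hℓ0]; linarith
        have := (abs_le.1 (Real.abs_exp_sub_one_sub_id_le hx)).2
        linarith
      have hdpos : 0 < d := lt_of_lt_of_le (by positivity) hd
      have e1 : ((n : ℝ) - 1) * (p * (Real.exp (2 / ℓ) - 1)) = d * (Real.exp (2 / ℓ) - 1) := by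
        rw [hd']; ring
      rw [e1]
      have e2 := mul_le_mul_of_nonneg_left he hdpos.le
      have e3 : -(2 / ℓ * ((1 + 4 / ℓ) * d)) + d * (2 / ℓ + (2 / ℓ) ^ 2) = -(4 * (d / ℓ ^ 2)) := by
        field_simp; ring
      have e4 : ℓ ≤ d / ℓ ^ 2 := by
        rw [le_div_iff₀ (by positivity)]; nlinarith
      linarith
  · intro i _ j _ hij
    rw [Set.disjoint_left]
    intro e he he'
    simp only [Set.mem_ofPred_eq] at he he'
    rw [he] at he'
    simp only [Sym2.eq_iff] at he'
    rcases he' with h | h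
    · exact hij h.2
    · exact hij (h.2.trans h.1)
  · intro i _
    exact adj_dep a i
  · intro i hi
    exact adj_prob p h0 h1 _ _ (Finset.ne_of_mem_erase hi).symm

lemma kids_static (p ℓ : ℝ) (h0 : 0 ≤ p) (h1 : p ≤ 1) (hℓ : 48 ≤ ℓ) (hn : 1 ≤ n)
    (hd : ℓ ^ 3 ≤ p * ((n : ℝ) - 1)) (X L : Finset (Fin n)) (hLX : L ⊆ X) (a : Fin n)
    (ha : a ∈ L) (hX : (X.card : ℝ) * p ≤ 12 / ℓ) :
    (gnp n p).real {ω | ((kids (graphOf ω) X L a).card : ℝ) ≤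
      (1 - 28 / ℓ) * (p * ((n : ℝ) - 1))} ≤ Real.exp (-(4 * ℓ)) := by
  set d := p * ((n : ℝ) - 1) with hd'
  have hℓ0 : 0 < ℓ := by linarith
  set q := p * (1 - p) ^ (L.card - 1) with hq
  have key := chernoff (nu p) Xᶜ
    (fun w => {ω : {e : Sym2 (Fin n) // ¬ e.IsDiag} → Bool |
      ∀ b ∈ L, ((graphOf ω).Adj b w ↔ b = a)})
    (fun w => {e | ∃ b ∈ L, e.1 = s(b, w)}) ?_ ?_ q ?_ (-(4 / ℓ)) ((1 - 28 / ℓ) * d)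
  · rw [← gnp_eq] at key
    refine (measureReal_mono ?_).trans (key.trans ?_)
    · intro ω hω
      simp only [Set.mem_ofPred_eq, kids] at hω ⊢
      exact mul_le_mul_of_nonpos_left hω (by rw [neg_nonpos]; positivity)
    · rw [Real.exp_le_exp]
      have hdpos : 0 < d := lt_of_lt_of_le (by positivity) hd
      have hn1 : 0 < (n : ℝ) - 1 := by
        by_contra h
        have : d ≤ 0 := mul_nonpos_of_nonneg_of_nonpos h0 (by linarith)
        linarith
      set x := 1 / ℓ with hx
      have hx0 : 0 < x := by positivity
      have hx1 : x ≤ 1 / 48 := by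
        rw [hx]; exact one_div_le_one_div_of_le (by norm_num) hℓ
      have r12 : 12 / ℓ = 12 * x := by rw [hx]; ring
      have r28 : 28 / ℓ = 28 * x := by rw [hx]; ring
      have r4 : 4 / ℓ = 4 * x := by rw [hx]; ring
      rw [r12] at hX
      rw [r28, r4]
      have hd1 : 1 ≤ d := by
        have : (1 : ℝ) ≤ ℓ ^ 3 := one_le_pow₀ (by linarith)
        linarith
      have hXn : (X.card : ℝ) ≤ 12 * x * ((n : ℝ) - 1) := by
        have h2 : (X.card : ℝ) * d ≤ 12 * x * ((n : ℝ) - 1) := by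
          rw [hd', ← mul_assoc]; exact mul_le_mul_of_nonneg_right hX hn1.le
        have h3 : (X.card : ℝ) * 1 ≤ (X.card : ℝ) * d :=
          mul_le_mul_of_nonneg_left hd1 (Nat.cast_nonneg _)
        linarith
      have hc : (1 - 12 * x) * ((n : ℝ) - 1) ≤ ((Xᶜ).card : ℝ) := by
        rw [Finset.card_compl, Nat.cast_sub (Finset.card_le_univ _), Fintype.card_fin]
        linarith
      have hqlo : p * (1 - 12 * x) ≤ q := by
        rw [hq]
        refine mul_le_mul_of_nonneg_left ?_ h0
        have hb := one_add_mul_le_pow (a := -p) (by linarith) (L.card - 1)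
        have hb2 : (((L.card - 1 : ℕ)) : ℝ) * p ≤ X.card * p := by
          refine mul_le_mul_of_nonneg_right ?_ h0
          have := Finset.card_le_card hLX
          exact_mod_cast (Nat.sub_le _ _).trans this
        have hb3 : (1 + -p) = 1 - p := by ring
        rw [hb3] at hb
        linarith
      set μ := ((Xᶜ).card : ℝ) * q with hμ
      have hμlo : (1 - 24 * x) * d ≤ μ := by
        have t1 : ((1 - 12 * x) * ((n : ℝ) - 1)) * (p * (1 - 12 * x)) ≤ μ := by
          refine mul_le_mul hc hqlo ?_ (Nat.cast_nonneg _)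
          exact mul_nonneg h0 (by linarith)
        have t2 : ((1 - 12 * x) * ((n : ℝ) - 1)) * (p * (1 - 12 * x))
            = (1 - 12 * x) ^ 2 * d := by rw [hd']; ring
        have t3 : (1 - 24 * x) * d ≤ (1 - 12 * x) ^ 2 * d := by
          refine mul_le_mul_of_nonneg_right ?_ hdpos.le
          nlinarith [sq_nonneg x]
        linarith
      have he : Real.exp (-(4 * x)) - 1 ≤ -(4 * x) + 8 * x ^ 2 := by
        have := Real.quadratic_le_exp_of_nonneg (x := 4 * x) (by linarith)
        have h5 : 0 < 1 + 4 * x + (4 * x) ^ 2 / 2 := by positivity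
        have h6 : Real.exp (-(4 * x)) ≤ (1 + 4 * x + (4 * x) ^ 2 / 2)⁻¹ := by
          rw [Real.exp_neg]; exact inv_anti₀ h5 this
        have h7 : (1 + 4 * x + (4 * x) ^ 2 / 2)⁻¹ ≤ 1 - 4 * x + 8 * x ^ 2 := by
          rw [inv_le_iff_one_le_mul₀ h5]
          nlinarith [sq_nonneg (x ^ 2), sq_nonneg x]
        linarith
      have e1 : ((Xᶜ).card : ℝ) * (q * (Real.exp (-(4 * x)) - 1))
          = μ * (Real.exp (-(4 * x)) - 1) := by rw [hμ]; ring
      rw [e1]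
      have hneg : -(4 * x) + 8 * x ^ 2 ≤ 0 := by nlinarith
      have hμ0 : 0 ≤ μ := le_trans (mul_nonneg (by linarith) hdpos.le) hμlo
      have e2 : μ * (Real.exp (-(4 * x)) - 1) ≤ μ * (-(4 * x) + 8 * x ^ 2) :=
        mul_le_mul_of_nonneg_left he hμ0
      have e3 : μ * (-(4 * x) + 8 * x ^ 2) ≤ ((1 - 24 * x) * d) * (-(4 * x) + 8 * x ^ 2) :=
        mul_le_mul_of_nonpos_right hμlo hneg
      have e4 : -(-(4 * x) * ((1 - 28 * x) * d)) + ((1 - 24 * x) * d) * (-(4 * x) + 8 * x ^ 2)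
          = -(d * x ^ 2 * (8 + 192 * x)) := by ring
      have e5 : ℓ ≤ d * x ^ 2 := by
        rw [hx, one_div, inv_pow, ← div_eq_mul_inv, le_div_iff₀ (by positivity)]; nlinarith
      have e6 : d * x ^ 2 * 8 ≤ d * x ^ 2 * (8 + 192 * x) :=
        mul_le_mul_of_nonneg_left (by linarith) (by positivity)
      linarith
  · intro i hi j hj hij
    rw [Set.disjoint_left]
    rintro e ⟨b, hb, he⟩ ⟨b', hb', he'⟩
    rw [he] at he'
    simp only [Sym2.eq_iff] at he'
    rcases he' with h | h
    · exact hij h.2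
    · exact (Finset.mem_compl.1 hj) (h.1 ▸ hLX hb)
  · intro i _ x y hxy
    simp only [Set.mem_ofPred_eq, eq_iff_iff]
    refine forall₂_congr fun b hb => ?_
    have := adj_dep b i (x := x) (y := y) (fun e he => hxy e ⟨b, hb, he⟩)
    simp only [eq_iff_iff] at this
    rw [this]
  · intro i hi
    exact star_prob p h0 h1 L a i ha (fun h => (Finset.mem_compl.1 hi) (hLX h))

lemma ball_invariant {x y : {e : Sym2 (Fin n) // ¬ e.IsDiag} → Bool} (v : Fin n) (k : ℕ)
    (hxy : ∀ e : {e : Sym2 (Fin n) // ¬ e.IsDiag},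
      (¬ ∃ b ∈ ball (graphOf x) v k \ pball (graphOf x) v k, ∃ w ∉ ball (graphOf x) v k,
        e.1 = s(b, w)) → x e = y e) (j : ℕ) (hj : j ≤ k) :
    ball (graphOf y) v j = ball (graphOf x) v j := by
  induction j with
  | zero => rfl
  | succ j ih =>
    have ih' := ih (by omega)
    ext w
    rw [mem_ball_succ, mem_ball_succ, ih']
    refine or_congr Iff.rfl (exists_congr fun b => and_congr_right fun hb => ?_)
    have := adj_dep b w (x := x) (y := y) ?_
    · simp only [eq_iff_iff] at this
      exact this.symm
    · intro e he
      refine hxy e ?_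
      rintro ⟨b', hb', w', hw', h⟩
      obtain ⟨k, rfl⟩ : ∃ k', k = k' + 1 := ⟨k - 1, by omega⟩
      rw [Finset.mem_sdiff] at hb'
      simp only [pball] at hb'
      have hbk : b ∈ ball (graphOf x) v k := ball_mono _ _ (by omega) hb
      have he2 : s(b, w) = s(b', w') := he.symm.trans h
      simp only [Sym2.eq_iff] at he2
      rcases he2 with h | h
      · exact hb'.2 (h.1 ▸ hbk)
      · exact hw' (h.1 ▸ ball_subset_succ _ _ _ hbk)

lemma hist_invariant {x y : {e : Sym2 (Fin n) // ¬ e.IsDiag} → Bool} (v : Fin n) (k : ℕ)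
    (hxy : ∀ e : {e : Sym2 (Fin n) // ¬ e.IsDiag},
      (¬ ∃ b ∈ ball (graphOf x) v k \ pball (graphOf x) v k, ∃ w ∉ ball (graphOf x) v k,
        e.1 = s(b, w)) → x e = y e) :
    ball (graphOf y) v k = ball (graphOf x) v k ∧
      pball (graphOf y) v k = pball (graphOf x) v k := by
  refine ⟨ball_invariant v k hxy k le_rfl, ?_⟩
  cases k with
  | zero => rfl
  | succ k => exact ball_invariant v (k + 1) hxy k (by omega)

lemma kids_bound (p ℓ : ℝ) (h0 : 0 ≤ p) (h1 : p ≤ 1) (hℓ : 48 ≤ ℓ) (hn : 1 ≤ n)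
    (hd : ℓ ^ 3 ≤ p * ((n : ℝ) - 1)) (v a : Fin n) (k : ℕ) :
    (gnp n p).real {ω | a ∈ ball (graphOf ω) v k \ pball (graphOf ω) v k ∧
      ((ball (graphOf ω) v k).card : ℝ) * p ≤ 12 / ℓ ∧
      ((kids (graphOf ω) (ball (graphOf ω) v k)
        (ball (graphOf ω) v k \ pball (graphOf ω) v k) a).card : ℝ) ≤
      (1 - 28 / ℓ) * (p * ((n : ℝ) - 1))} ≤ Real.exp (-(4 * ℓ)) := by
  have key := history_bound (H := Finset (Fin n) × Finset (Fin n)) (nu p)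
    (fun ω : {e : Sym2 (Fin n) // ¬ e.IsDiag} → Bool =>
      (ball (graphOf ω) v k, pball (graphOf ω) v k))
    (fun x => {ω | a ∈ x.1 \ x.2 ∧ (x.1.card : ℝ) * p ≤ 12 / ℓ ∧
      ((kids (graphOf ω) x.1 (x.1 \ x.2) a).card : ℝ) ≤ (1 - 28 / ℓ) * (p * ((n : ℝ) - 1))})
    (fun x => {e | ∃ b ∈ x.1 \ x.2, ∃ w ∉ x.1, e.1 = s(b, w)})
    (Real.exp (-(4 * ℓ))) ?_ ?_ ?_
  · exact key
  · rintro ⟨X, Q⟩ x y hxy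
    simp only [eq_iff_iff, Prod.mk.injEq]
    constructor
    · rintro ⟨rfl, rfl⟩
      exact hist_invariant v k hxy
    · rintro ⟨rfl, rfl⟩
      exact hist_invariant v k (fun e he => (hxy e he).symm)
  · rintro ⟨X, Q⟩ x y hxy
    have : kids (graphOf x) X (X \ Q) a = kids (graphOf y) X (X \ Q) a := by
      unfold kids
      refine Finset.filter_congr fun w hw => forall₂_congr fun b hb => ?_
      have := adj_dep b w (x := x) (y := y)
        (fun e he => hxy e ⟨b, hb, w, Finset.mem_compl.1 hw, he⟩)
      simp only [eq_iff_iff] at this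
      rw [this]
    simp only [Set.mem_ofPred_eq, this]
  · rintro ⟨X, Q⟩
    rw [← gnp_eq]
    by_cases h : a ∈ X \ Q ∧ (X.card : ℝ) * p ≤ 12 / ℓ
    · refine le_trans (measureReal_mono ?_)
        (kids_static p ℓ h0 h1 hℓ hn hd X (X \ Q) Finset.sdiff_subset a h.1 h.2)
      intro ω hω
      exact hω.2.2
    · have : {ω : {e : Sym2 (Fin n) // ¬ e.IsDiag} → Bool | a ∈ X \ Q ∧ (X.card : ℝ) * p ≤ 12 / ℓ ∧
        ((kids (graphOf ω) X (X \ Q) a).card : ℝ) ≤ (1 - 28 / ℓ) * (p * ((n : ℝ) - 1))} = ∅ := by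
        ext ω
        simp only [Set.mem_ofPred_eq, Set.mem_empty_iff_false, iff_false]
        tauto
      simp only [this, measureReal_empty]
      positivity

end Prob
section Final
open Classical

def GoodSet (n : ℕ) (p η : ℝ) : Set (Om n) :=
  {ω | ∀ v : Fin n, ∀ r : ℕ,
          Real.sqrt n < (p * ((n : ℝ) - 1)) ^ (r + 1) →
          (p * ((n : ℝ) - 1)) ^ (r + 1) ≤ Real.sqrt n * Real.log n →
          ∃ W : Fin n → Set (Fin n),
            (∀ u ∈ sphere (graphOf ω) v r, W u ⊆ sphere (graphOf ω) u (r + 1)) ∧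
            ((sphere (graphOf ω) v r).Pairwise fun u₁ u₂ => Disjoint (W u₁) (W u₂)) ∧
            (∀ u ∈ sphere (graphOf ω) v r,
              (1 - η) * (p * ((n : ℝ) - 1)) ^ (r + 1) ≤ ((W u).ncard : ℝ) ∧
              ((W u).ncard : ℝ) ≤ (1 + η) * (p * ((n : ℝ) - 1)) ^ (r + 1))}

lemma numeric (n r k : ℕ) (p ℓ d : ℝ) (hn : 2 ≤ n) (hℓ : 48 ≤ ℓ)
    (hdd : d = p * ((n : ℝ) - 1)) (h0 : 0 ≤ p)
    (hd : ℓ ^ 3 ≤ d) (hr16 : 16 * (r : ℝ) ≤ ℓ) (hup : d ^ (r + 1) ≤ Real.sqrt n * ℓ)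
    (hk : k ≤ 2 * r) :
    (2 * ((1 + 4 / ℓ) * d) ^ k - 1) * p ≤ 12 / ℓ := by
  have hℓ0 : 0 < ℓ := by linarith
  have hd1 : 1 ≤ d := (one_le_pow₀ (by linarith : (1 : ℝ) ≤ ℓ)).trans hd
  have hn1 : (2 : ℝ) ≤ n := by exact_mod_cast hn
  have hn0 : 0 < (n : ℝ) - 1 := by linarith
  have hD1 : 1 ≤ (1 + 4 / ℓ) * d := by
    have : 0 < 4 / ℓ := by positivity
    nlinarith
  have s1 : ((1 + 4 / ℓ) * d) ^ k ≤ ((1 + 4 / ℓ) * d) ^ (2 * r) := pow_le_pow_right₀ hD1 hk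
  have s2 : (1 + 4 / ℓ) ^ (2 * r) ≤ 3 := by
    calc (1 + 4 / ℓ) ^ (2 * r) ≤ (Real.exp (4 / ℓ)) ^ (2 * r) := by
          refine pow_le_pow_left₀ (by positivity) ?_ _
          linarith [Real.add_one_le_exp (4 / ℓ)]
      _ = Real.exp (((2 * r : ℕ) : ℝ) * (4 / ℓ)) := by rw [Real.exp_nat_mul]
      _ ≤ Real.exp 1 := by
          rw [Real.exp_le_exp]
          push_cast
          rw [← mul_div_assoc, div_le_one hℓ0]
          linarith
      _ ≤ 3 := by linarith [Real.exp_one_lt_d9]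
  rw [mul_pow _ _ (2 * r)] at s1
  have s3 : (1 + 4 / ℓ) ^ (2 * r) * d ^ (2 * r) ≤ 3 * d ^ (2 * r) :=
    mul_le_mul_of_nonneg_right s2 (by positivity)
  have s4 : (2 * ((1 + 4 / ℓ) * d) ^ k - 1) * p ≤ 6 * d ^ (2 * r) * p :=
    mul_le_mul_of_nonneg_right (by linarith) h0
  refine s4.trans ?_
  rw [le_div_iff₀ hℓ0]
  have s5 : (d ^ (r + 1)) ^ 2 ≤ n * ℓ ^ 2 := by
    calc (d ^ (r + 1)) ^ 2 ≤ (Real.sqrt n * ℓ) ^ 2 := pow_le_pow_left₀ (by positivity) hup 2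
      _ = n * ℓ ^ 2 := by rw [mul_pow, Real.sq_sqrt (by positivity)]
  have s6 : (d ^ (2 * r) * p * ((n : ℝ) - 1)) * d = (d ^ (r + 1)) ^ 2 := by
    rw [mul_assoc (d ^ (2 * r)), ← hdd]; ring
  have s7 : (d ^ (2 * r) * p * ((n : ℝ) - 1)) * ℓ ^ 3 ≤ n * ℓ ^ 2 := by
    refine le_trans (mul_le_mul_of_nonneg_left hd (by positivity)) ?_
    rw [s6]; exact s5
  have s8 : (6 * d ^ (2 * r) * p * ℓ) * (((n : ℝ) - 1) * ℓ ^ 2) ≤ 12 * (((n : ℝ) - 1) * ℓ ^ 2) := by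
    have : 6 * (n * ℓ ^ 2) ≤ 12 * (((n : ℝ) - 1) * ℓ ^ 2) := by
      have : (n : ℝ) * ℓ ^ 2 ≤ (2 * ((n : ℝ) - 1)) * ℓ ^ 2 :=
        mul_le_mul_of_nonneg_right (by linarith) (by positivity)
      linarith
    calc _ = 6 * ((d ^ (2 * r) * p * ((n : ℝ) - 1)) * ℓ ^ 3) := by ring
      _ ≤ 6 * (n * ℓ ^ 2) := by linarith
      _ ≤ _ := this
  exact le_of_mul_le_mul_right s8 (by positivity)

lemma core (n : ℕ) (p η : ℝ) (hη0 : 0 < η) (hη1 : η < 1) (hn : 2 ≤ n) (h0 : 0 ≤ p) (h1 : p ≤ 1)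
    (hℓ : 48 ≤ Real.log n) (hd : (Real.log n) ^ 3 ≤ p * ((n : ℝ) - 1))
    (h16 : 16 ≤ Real.log (p * ((n : ℝ) - 1))) (h28 : 28 / η ≤ Real.log (p * ((n : ℝ) - 1)))
    (hsq : Real.sqrt n * Real.log n ≤ n) (hbig : 1 ≤ 2 * η * Real.sqrt n) :
    (gnp n p).real (GoodSet n p η)ᶜ ≤ 2 / n := by
  set ℓ := Real.log n with hℓdef
  set d := p * ((n : ℝ) - 1) with hdd
  have hℓ0 : 0 < ℓ := by linarith
  have hn1 : (2 : ℝ) ≤ n := by exact_mod_cast hn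
  have hd1 : 1 ≤ d := (one_le_pow₀ (by linarith : (1 : ℝ) ≤ ℓ)).trans hd
  have hd2 : 2 ≤ d := by
    have : ℓ ^ 1 ≤ ℓ ^ 3 := pow_le_pow_right₀ (by linarith) (by norm_num)
    rw [pow_one] at this
    linarith
  let B1 : Fin n → Set (Om n) := fun a => {ω | (1 + 4 / ℓ) * d ≤
      ((Finset.univ.filter fun w => (graphOf ω).Adj a w).card : ℝ)}
  let B2 : Fin n × Fin n × Fin n → Set (Om n) := fun i =>
    {ω | i.2.1 ∈ ball (graphOf ω) i.1 i.2.2 \ pball (graphOf ω) i.1 i.2.2 ∧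
      ((ball (graphOf ω) i.1 i.2.2).card : ℝ) * p ≤ 12 / ℓ ∧
      ((kids (graphOf ω) (ball (graphOf ω) i.1 i.2.2)
        (ball (graphOf ω) i.1 i.2.2 \ pball (graphOf ω) i.1 i.2.2) i.2.1).card : ℝ) ≤
      (1 - 28 / ℓ) * d}
  have hsub : (GoodSet n p η)ᶜ ⊆ (⋃ a, B1 a) ∪ ⋃ i, B2 i := by
    rw [Set.compl_subset_comm]
    intro ω hω
    simp only [Set.mem_compl_iff, Set.mem_union, Set.mem_iUnion, not_or, not_exists] at hω
    obtain ⟨hω1, hω2⟩ := hω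
    intro v r hlow hup
    rw [← hdd] at hlow hup ⊢
    have hrd : ((r : ℝ) + 1) * Real.log d ≤ ℓ := by
      have : Real.log (d ^ (r + 1)) ≤ Real.log n :=
        Real.log_le_log (by positivity) (hup.trans hsq)
      rw [Real.log_pow] at this
      push_cast at this
      exact this
    have hr16 : 16 * (r : ℝ) ≤ ℓ := by
      have : ((r : ℝ) + 1) * 16 ≤ ((r : ℝ) + 1) * Real.log d :=
        mul_le_mul_of_nonneg_left h16 (by positivity)
      linarith
    have hr28 : 28 * ((r : ℝ) + 1) ≤ η * ℓ := by
      have e1 : ((r : ℝ) + 1) * (28 / η) ≤ ℓ :=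
        (mul_le_mul_of_nonneg_left h28 (by positivity)).trans hrd
      have e2 := mul_le_mul_of_nonneg_left e1 hη0.le
      have e3 : η * (((r : ℝ) + 1) * (28 / η)) = 28 * ((r : ℝ) + 1) := by field_simp
      linarith
    have h2rn : 2 * r < n := by
      have : ℓ ≤ (n : ℝ) := by
        have := Real.log_le_sub_one_of_pos (show (0 : ℝ) < n by linarith)
        linarith
      have h3 : ((2 * r : ℕ) : ℝ) < n := by push_cast; linarith
      exact_mod_cast h3
    have hx : 28 / ℓ ≤ 1 := by rw [div_le_one hℓ0]; linarith
    refine det_main (graphOf ω) v r ((1 - 28 / ℓ) * d) ((1 - η) * d ^ (r + 1))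
      ((1 + η) * d ^ (r + 1))
      (mul_nonneg (by linarith) (by linarith)) ?_ ?_
      (mul_nonneg (by linarith) (by positivity)) ?_
    · intro j hj a ha
      have hb := ball_card_le (graphOf ω) v ((1 + 4 / ℓ) * d)
        (by have : 0 < 4 / ℓ := by positivity
            nlinarith) (fun a => (not_le.1 (hω1 a)).le) (r + j)
      have hnum := numeric n r (r + j) p ℓ d hn hℓ hdd h0 hd hr16 hup (by omega)
      have hb2 := (mul_le_mul_of_nonneg_right hb h0).trans hnum
      have := hω2 (v, a, ⟨r + j, by omega⟩)
      simp only [B2, Set.mem_ofPred_eq, not_and, not_le] at this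
      exact (this ha hb2).le
    · rw [mul_pow (1 - 28 / ℓ) d]
      have hdp : 0 ≤ d ^ (r + 1) := by positivity
      refine mul_le_mul_of_nonneg_right ?_ hdp
      have hb := one_add_mul_le_pow (a := -(28 / ℓ)) (by linarith) (r + 1)
      have e1 : (1 : ℝ) + -(28 / ℓ) = 1 - 28 / ℓ := by ring
      rw [e1] at hb
      refine le_trans ?_ hb
      push_cast
      have e2 : ((r : ℝ) + 1) * (28 / ℓ) ≤ η := by
        rw [← mul_div_assoc, div_le_iff₀ hℓ0]; linarith
      linarith
    · have : 2 * η * Real.sqrt n ≤ 2 * η * d ^ (r + 1) :=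
        mul_le_mul_of_nonneg_left hlow.le (by linarith)
      linarith
  have hexp : Real.exp (-(4 * ℓ)) = 1 / (n : ℝ) ^ 4 := by
    rw [Real.exp_neg, one_div]
    congr 1
    have : (4 : ℝ) * ℓ = ((4 : ℕ) : ℝ) * ℓ := by norm_num
    rw [this, Real.exp_nat_mul, hℓdef, Real.exp_log (by linarith)]
  have hB1 : (gnp n p).real (⋃ a, B1 a) ≤ n * (1 / (n : ℝ) ^ 4) := by
    refine (measureReal_iUnion_fintype_le _).trans ?_
    refine (Finset.sum_le_card_nsmul _ _ (1 / (n : ℝ) ^ 4) fun a _ => ?_).trans ?_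
    · rw [← hexp]
      exact deg_bound p ℓ h0 h1 (by linarith) (by omega) hd a
    · simp
  have hB2 : (gnp n p).real (⋃ i, B2 i) ≤ (n : ℝ) ^ 3 * (1 / (n : ℝ) ^ 4) := by
    refine (measureReal_iUnion_fintype_le _).trans ?_
    refine (Finset.sum_le_card_nsmul _ _ (1 / (n : ℝ) ^ 4) fun i _ => ?_).trans ?_
    · rw [← hexp]
      exact kids_bound p ℓ h0 h1 hℓ (by omega) hd i.1 i.2.1 i.2.2
    · apply le_of_eq
      simp only [Finset.card_univ, Fintype.card_prod, Fintype.card_fin, nsmul_eq_mul]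
      push_cast
      ring
  have hn0 : (0 : ℝ) < n := by linarith
  have e1 : (n : ℝ) ^ 3 * (1 / (n : ℝ) ^ 4) = 1 / n := by field_simp
  have e2 : (n : ℝ) * (1 / (n : ℝ) ^ 4) ≤ 1 / n := by
    rw [← e1]
    refine mul_le_mul_of_nonneg_right ?_ (by positivity)
    exact le_self_pow₀ (by linarith) (by norm_num)
  calc (gnp n p).real (GoodSet n p η)ᶜ ≤ (gnp n p).real ((⋃ a, B1 a) ∪ ⋃ i, B2 i) :=
        measureReal_mono hsub
    _ ≤ _ := measureReal_union_le _ _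
    _ ≤ 1 / n + 1 / n := by linarith
    _ = 2 / n := by ring

lemma good_of_large (n : ℕ) (p η : ℝ) (h1 : 1 < p) (hn : 2 ≤ n)
    (hsq : Real.sqrt n * Real.log n ≤ n - 1) : GoodSet n p η = Set.univ := by
  rw [Set.eq_univ_iff_forall]
  intro ω v r _ hup
  exfalso
  have hn1 : (2 : ℝ) ≤ n := by exact_mod_cast hn
  have h2 : (n : ℝ) - 1 < p * ((n : ℝ) - 1) := by nlinarith
  have h3 : p * ((n : ℝ) - 1) ≤ (p * ((n : ℝ) - 1)) ^ (r + 1) :=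
    le_self_pow₀ (by linarith) (by omega)
  linarith

open Filter in
lemma main_tendsto (p : ℕ → ℝ)
    (hd : ∀ n : ℕ, 2 ≤ n → (Real.log n) ^ 3 ≤ p n * ((n : ℝ) - 1))
    (η : ℝ) (hη0 : 0 < η) (hη1 : η < 1) :
    Tendsto (fun n : ℕ => gnp n (p n) (GoodSet n (p n) η)) atTop (nhds 1) := by
  have hcast : Tendsto (fun n : ℕ => (n : ℝ)) atTop atTop := tendsto_natCast_atTop_atTop
  have hlog : Tendsto (fun n : ℕ => Real.log n) atTop atTop := Real.tendsto_log_atTop.comp hcast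
  have hloglog : Tendsto (fun n : ℕ => Real.log (Real.log n)) atTop atTop :=
    Real.tendsto_log_atTop.comp hlog
  have hsqrt : Tendsto (fun n : ℕ => Real.sqrt n) atTop atTop := Real.tendsto_sqrt_atTop.comp hcast
  have hlogsq : ∀ᶠ n : ℕ in atTop, Real.log n ≤ 1 / 2 * Real.sqrt n := by
    have := (isLittleO_log_rpow_atTop (r := 1 / 2) (by norm_num)).comp_tendsto hcast
    filter_upwards [this.bound (c := 1 / 2) (by norm_num), eventually_ge_atTop 1] with n hn h1
    simp only [Function.comp, ← Real.sqrt_eq_rpow, Real.norm_eq_abs] at hn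
    rw [abs_of_nonneg (Real.sqrt_nonneg _)] at hn
    exact (le_abs_self _).trans hn
  have hfin : ∀ᶠ n : ℕ in atTop, (gnp n (p n)).real (GoodSet n (p n) η)ᶜ ≤ 2 / n := by
    filter_upwards [hlogsq, hlog.eventually_ge_atTop 48, hloglog.eventually_ge_atTop 16,
      hloglog.eventually_ge_atTop (28 / η), hsqrt.eventually_ge_atTop (1 / (2 * η)),
      eventually_ge_atTop 2] with n h1 h2 h3 h4 h5 h6
    have hn2 : (2 : ℝ) ≤ n := by exact_mod_cast h6
    have hsq : Real.sqrt n * Real.log n ≤ n - 1 := by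
      have e1 : Real.sqrt n * Real.log n ≤ Real.sqrt n * (1 / 2 * Real.sqrt n) :=
        mul_le_mul_of_nonneg_left h1 (Real.sqrt_nonneg _)
      have e2 : Real.sqrt n * (1 / 2 * Real.sqrt n) = n / 2 := by
        have := Real.mul_self_sqrt (show (0 : ℝ) ≤ n by linarith)
        linarith
      linarith
    by_cases hp : p n ≤ 1
    · have hdn := hd n h6
      have hdpos : 0 < p n * ((n : ℝ) - 1) := lt_of_lt_of_le (by positivity) hdn
      have hp0 : 0 ≤ p n := by
        by_contra h
        nlinarith
      have hld : Real.log (Real.log n) ≤ Real.log (p n * ((n : ℝ) - 1)) := by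
        refine Real.log_le_log (by linarith) (le_trans ?_ hdn)
        exact le_self_pow₀ (by linarith) (by norm_num)
      refine core n (p n) η hη0 hη1 h6 hp0 hp h2 hdn (by linarith) (by linarith) (by linarith) ?_
      rw [div_le_iff₀ (by positivity)] at h5
      linarith
    · rw [good_of_large n (p n) η (not_le.1 hp) h6 hsq]
      simp only [Set.compl_univ, measureReal_empty]
      positivity
  have hz : Tendsto (fun n : ℕ => (gnp n (p n)).real (GoodSet n (p n) η)ᶜ) atTop (nhds 0) := by
    refine squeeze_zero' (Eventually.of_forall fun n => measureReal_nonneg) hfin ?_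
    exact tendsto_const_div_atTop_nhds_zero_nat 2
  have hone : Tendsto (fun n : ℕ => (gnp n (p n)).real (GoodSet n (p n) η)) atTop (nhds 1) := by
    have := hz.const_sub 1
    rw [sub_zero] at this
    refine this.congr fun n => ?_
    rw [measureReal_compl MeasurableSet.of_discrete]
    simp
  have h := ENNReal.tendsto_ofReal hone
  rw [ENNReal.ofReal_one] at h
  refine h.congr fun n => ?_
  exact ofReal_measureReal

end Final

/-- If `d = p(n-1) ≥ log³ n`, then for every `η ∈ (0,1)`, a.a.s. in
`G(n,p)`: for every vertex `v` and every `r : ℕ` with `√n < d^(r+1) ≤ √n log n`, there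
is a family `{W(u) ⊆ S(u,r+1) : u ∈ S(v,r)}` of pairwise disjoint subsets with
`(1-η) d^(r+1) ≤ |W(u)| ≤ (1+η) d^(r+1)` for each `u ∈ S(v,r)`. -/
theorem stmt_10 (p : ℕ → ℝ)
    (hd : ∀ n : ℕ, 2 ≤ n → (Real.log n) ^ 3 ≤ p n * ((n : ℝ) - 1))
    (η : ℝ) (hη0 : 0 < η) (hη1 : η < 1) :
    Filter.Tendsto (fun n : ℕ =>
        gnp n (p n) {ω | ∀ v : Fin n, ∀ r : ℕ,
          Real.sqrt n < (p n * ((n : ℝ) - 1)) ^ (r + 1) →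
          (p n * ((n : ℝ) - 1)) ^ (r + 1) ≤ Real.sqrt n * Real.log n →
          ∃ W : Fin n → Set (Fin n),
            (∀ u ∈ sphere (graphOf ω) v r, W u ⊆ sphere (graphOf ω) u (r + 1)) ∧
            ((sphere (graphOf ω) v r).Pairwise fun u₁ u₂ => Disjoint (W u₁) (W u₂)) ∧
            (∀ u ∈ sphere (graphOf ω) v r,
              (1 - η) * (p n * ((n : ℝ) - 1)) ^ (r + 1) ≤ ((W u).ncard : ℝ) ∧
              ((W u).ncard : ℝ) ≤ (1 + η) * (p n * ((n : ℝ) - 1)) ^ (r + 1))})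
      Filter.atTop (nhds 1) := by
  exact main_tendsto p hd η hη0 hη1
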